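/- arXiv:1304.7344 — 2 statements merged into one kernel-verified Lean document; each statement's English description precedes it below -/
import Mathlib

section
/- Let V be a finite type, let s, d ∈ V with s ≠ d, let N ≥ 2, and let v_1, …, v_N ∈ V be pairwise distinct, with the convention v_{N+1} = v_1 and v_0 = v_N. Let f : Set V → ℝ and f_k : Set V → ℝ for k = 1, …, N all be submodular, and assume f S = f_k S for every k and every S ⊆ V with ¬(v_k ∈ S ∧ v_{k+1} ∉ S). Further, for k = 2, …, N let g_k : Set V → ℝ be submodular with f_{k−1} S = g_k S for every S with ¬(v_k ∈ S ∧ v_{k+1} ∉ S), and f_k S = g_k S for every S with ¬(v_{k−1} ∈ S ∧ v_k ∉ S). Then there exists k ∈ {1, …, N} such that the minimum of f_k over all s–d cuts equals the minimum of f over all s–d cuts. -/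
/-- A function `g : Set V → ℝ` is submodular if
`g S1 + g S2 ≥ g (S1 ∪ S2) + g (S1 ∩ S2)` for all `S1, S2 ⊆ V`. -/
def Submodular {V : Type*} (g : Set V → ℝ) : Prop :=
  ∀ S1 S2 : Set V, g (S1 ∪ S2) + g (S1 ∩ S2) ≤ g S1 + g S2

/-- The minimum of `f` over all `s`–`d` cuts, i.e. over all `S ⊆ V` with `s ∈ S` and
`d ∉ S`.  For `V` finite and `s ≠ d` this collection is finite and nonempty, so the
infimum below is attained and is the minimum. -/
noncomputable def cutMin {V : Type*} (s d : V) (f : Set V → ℝ) : ℝ :=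
  sInf (f '' {S : Set V | s ∈ S ∧ d ∉ S})

theorem cutMin_le {V : Type*} [Finite V] {s d : V} (f : Set V → ℝ) {S : Set V}
    (hs : s ∈ S) (hd : d ∉ S) : cutMin s d f ≤ f S :=
  csInf_le (Set.toFinite _).bddBelow ⟨S, ⟨hs, hd⟩, rfl⟩

theorem exists_eq_cutMin {V : Type*} [Finite V] {s d : V} (hsd : s ≠ d) (f : Set V → ℝ) :
    ∃ S : Set V, s ∈ S ∧ d ∉ S ∧ f S = cutMin s d f := by
  have hne : (f '' {S : Set V | s ∈ S ∧ d ∉ S}).Nonempty :=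
    ⟨_, {s}, ⟨rfl, fun h => hsd h.symm⟩, rfl⟩
  obtain ⟨S, ⟨hs, hd⟩, hS⟩ := hne.csInf_mem (Set.toFinite _)
  exact ⟨S, hs, hd, hS⟩

/-- If removing the link `(a, b)` strictly decreases the min-cut, then a minimum cut of the
original network cannot be entered by that link. -/
theorem mem_of_mem_of_cutMin_lt {V : Type*} [Finite V] {s d a b : V} (hsd : s ≠ d)
    {f h : Set V → ℝ} (hh : Submodular h) (hfh : ∀ S : Set V, ¬(a ∈ S ∧ b ∉ S) → f S = h S)
    (hlt : cutMin s d h < cutMin s d f) {A : Set V} (hs : s ∈ A) (hd : d ∉ A)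
    (hA : f A = cutMin s d f) (hb : b ∈ A) : a ∈ A := by
  by_contra ha
  obtain ⟨C, hsC, hdC, hC⟩ := exists_eq_cutMin hsd h
  have hsub := hh A C
  rw [← hfh A (fun h => ha h.1), ← hfh (A ∪ C) (fun h => h.2 (Or.inl hb)),
    ← hfh (A ∩ C) (fun h => ha h.1.1)] at hsub
  have hunion : cutMin s d f ≤ f (A ∪ C) := cutMin_le f (Or.inl hs) (fun h => h.elim hd hdC)
  have hinter : cutMin s d f ≤ f (A ∩ C) := cutMin_le f ⟨hs, hsC⟩ (fun h => hd h.1)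
  linarith

/-- A property of `1, …, N + 1` that propagates downwards and passes from `1` to `N + 1` also
propagates upwards. -/
theorem forall_succ_of_forall_pred {N : ℕ} {p : ℕ → Prop}
    (hp : ∀ j, 1 ≤ j → j ≤ N → p (j + 1) → p j) (hwrap : p 1 → p (N + 1))
    {j : ℕ} (hj : 1 ≤ j) (hjN : j ≤ N) (h : p j) : p (j + 1) := by
  have down : ∀ {a b : ℕ}, 1 ≤ a → a ≤ b → b ≤ N + 1 → p b → p a := by
    intro a b ha hab
    induction b, hab using Nat.le_induction with
    | base => exact fun _ h => h
    | succ b hab ih => exact fun hb h => ih (by omega) (hp b (by omega) (by omega) h)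
  exact down (by omega) (by omega) le_rfl (hwrap (down le_rfl hj (by omega) h))

/-- Let the nodes `v 1, …, v N` (pairwise distinct, with the
conventions `v (N+1) = v 1` and `v 0 = v N`) form a cycle in a directed network `G`
with cut function `f`.  Let `fk k` be the cut function of `G` with the link
`(v k, v (k+1))` removed, and `g k` (for `2 ≤ k ≤ N`) that of `G` with both links
`(v (k-1), v k)` and `(v k, v (k+1))` removed.  Then removing some link of the cycle
preserves the min-cut: there exists `k ∈ {1, …, N}` with
`cutMin s d (fk k) = cutMin s d f`. -/
theorem mincut_remove_cycle_link {V : Type*} [Fintype V]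
    (s d : V) (hsd : s ≠ d)
    (N : ℕ) (hN : 2 ≤ N) (v : ℕ → V)
    (hinj : Set.InjOn v (Set.Icc 1 N))
    (hconv1 : v (N + 1) = v 1) (hconv0 : v 0 = v N)
    (f : Set V → ℝ) (fk : ℕ → Set V → ℝ)
    (hf : Submodular f)
    (hfk : ∀ k, 1 ≤ k → k ≤ N → Submodular (fk k))
    (hffk : ∀ k, 1 ≤ k → k ≤ N →
      ∀ S : Set V, ¬(v k ∈ S ∧ v (k + 1) ∉ S) → f S = fk k S)
    (g : ℕ → Set V → ℝ)
    (hg : ∀ k, 2 ≤ k → k ≤ N → Submodular (g k))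
    (hg1 : ∀ k, 2 ≤ k → k ≤ N →
      ∀ S : Set V, ¬(v k ∈ S ∧ v (k + 1) ∉ S) → fk (k - 1) S = g k S)
    (hg2 : ∀ k, 2 ≤ k → k ≤ N →
      ∀ S : Set V, ¬(v (k - 1) ∈ S ∧ v k ∉ S) → fk k S = g k S) :
    ∃ k, 1 ≤ k ∧ k ≤ N ∧ cutMin s d (fk k) = cutMin s d f := by
  by_contra! hne
  obtain ⟨A, hsA, hdA, hA⟩ := exists_eq_cutMin hsd f
  have hlt_of : ∀ k, 1 ≤ k → k ≤ N → ¬(v k ∈ A ∧ v (k + 1) ∉ A) →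
      cutMin s d (fk k) < cutMin s d f := fun k hk hkN hcross =>
    lt_of_le_of_ne (by rw [← hA, hffk k hk hkN A hcross]; exact cutMin_le _ hsA hdA)
      (hne k hk hkN)
  have hdown : ∀ k, 1 ≤ k → k ≤ N → v (k + 1) ∈ A → v k ∈ A := fun k hk hkN hmem =>
    mem_of_mem_of_cutMin_lt hsd (hfk k hk hkN) (hffk k hk hkN)
      (hlt_of k hk hkN fun h => h.2 hmem) hsA hdA hA hmem
  have hlt : ∀ k, 1 ≤ k → k ≤ N → cutMin s d (fk k) < cutMin s d f := fun k hk hkN =>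
    hlt_of k hk hkN fun h => h.2 <|
      forall_succ_of_forall_pred (p := fun j => v j ∈ A) hdown (fun h => hconv1 ▸ h) hk hkN h.1
  have hcross : ∀ k, 1 ≤ k → k ≤ N → ∀ S : Set V, s ∈ S → d ∉ S →
      fk k S = cutMin s d (fk k) → v k ∈ S ∧ v (k + 1) ∉ S := by
    intro k hk hkN S hs hd hS
    by_contra h
    have hle := cutMin_le f hs hd
    rw [hffk k hk hkN S h, hS] at hle
    exact hle.not_gt (hlt k hk hkN)
  have hchain : ∀ k, 1 ≤ k → k ≤ N →
      ∃ S : Set V, s ∈ S ∧ d ∉ S ∧ fk k S = cutMin s d (fk k) ∧ v 1 ∈ S := by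
    intro k hk
    induction k, hk using Nat.le_induction with
    | base =>
      intro h1N
      obtain ⟨S, hs, hd, hS⟩ := exists_eq_cutMin hsd (fk 1)
      exact ⟨S, hs, hd, hS, (hcross 1 le_rfl h1N S hs hd hS).1⟩
    | succ k hk ih =>
      intro hkN
      obtain ⟨S, hs, hd, hS, h1⟩ := ih (by omega)
      obtain ⟨T, hsT, hdT, hT⟩ := exists_eq_cutMin hsd (fk (k + 1))
      have hvS := (hcross k hk (by omega) S hs hd hS).2
      have hvT := (hcross (k + 1) (by omega) hkN T hsT hdT hT).1
      have hg1 := hg1 (k + 1) (by omega) hkN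
      have hg2 := hg2 (k + 1) (by omega) hkN
      rw [Nat.add_sub_cancel] at hg1 hg2
      have hsub := hg (k + 1) (by omega) hkN S T
      rw [← hg2 (S ∪ T) (fun h => h.2 (Or.inr hvT)), ← hg1 (S ∩ T) (fun h => hvS h.1.1),
        ← hg1 S (fun h => hvS h.1), ← hg2 T (fun h => h.2 hvT)] at hsub
      have hdU : d ∉ S ∪ T := fun h => h.elim hd hdT
      have hinter : cutMin s d (fk k) ≤ fk k (S ∩ T) := cutMin_le _ ⟨hs, hsT⟩ (fun h => hd h.1)
      exact ⟨S ∪ T, Or.inl hs, hdU,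
        le_antisymm (by linarith) (cutMin_le _ (Or.inl hs) hdU), Or.inl h1⟩
  obtain ⟨S, hs, hd, hS, h1⟩ := hchain N (by omega) le_rfl
  exact (hcross N (by omega) le_rfl S hs hd hS).2 (hconv1 ▸ h1)
end

section
/- Let s ∈ V be a source node and d_1, …, d_n ∈ V destination nodes with s ≠ d_i for all i, and let R_1, …, R_n ≥ 0 be rates. Assume that for every S ⊆ V with s ∈ S, Σ_{i : d_i ∉ S} R_i ≤ f_H(S). Then there exists an acyclic edge set E' ⊆ V × V such that the E'-subnetwork H' of H satisfies: for every S ⊆ V with s ∈ S, Σ_{i : d_i ∉ S} R_i ≤ f_{H'}(S). -/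
open Matrix Complex

open scoped Classical

/-- The submatrix of the channel matrix `H` corresponding to a cut `S`:
rows are the receive antennas owned by nodes outside `S`, columns are the
transmit antennas owned by nodes inside `S`. -/
noncomputable def cutMatrix {V T Rx : Type*} (τ : T → V) (ρ : Rx → V)
    (H : Matrix Rx T ℂ) (S : Set V) :
    Matrix {r : Rx // ρ r ∉ S} {t : T // τ t ∈ S} ℂ :=
  fun r t => H r.1 t.1

/-- The Gaussian cut value `f_H(S) = log re (det (1 + H_S * diagonal p * H_Sᴴ))`. -/
noncomputable def cutValue {V T Rx : Type*} [Fintype T] [Fintype Rx]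
    (τ : T → V) (ρ : Rx → V) (H : Matrix Rx T ℂ) (p : T → ℝ) (S : Set V) : ℝ :=
  Real.log ((1 + cutMatrix τ ρ H S *
      Matrix.diagonal (fun t : {t : T // τ t ∈ S} => (p t.1 : ℂ)) *
      (cutMatrix τ ρ H S)ᴴ).det.re)

/-- An edge set `E ⊆ V × V` is acyclic if the transitive closure of the corresponding
relation is irreflexive (no directed cycles; in particular no self-loops and no pair of
oppositely directed edges). -/
def AcyclicEdgeSet {V : Type*} (E : Set (V × V)) : Prop :=
  Irreflexive (Relation.TransGen fun u w => (u, w) ∈ E)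

/-- The `E`-subnetwork of the channel matrix `H`: keep the entry `H r t` if the edge
`(τ t, ρ r)` is in `E`, and set it to zero otherwise. -/
noncomputable def subnetwork {V T Rx : Type*} (τ : T → V) (ρ : Rx → V)
    (H : Matrix Rx T ℂ) (E : Set (V × V)) : Matrix Rx T ℂ :=
  fun r t => if (τ t, ρ r) ∈ E then H r t else 0

open scoped ComplexOrder

namespace Matrix

lemma PosSemidef.one_le_det_one_add {m : Type*} [Fintype m] [DecidableEq m]
    {A : Matrix m m ℂ} (hA : A.PosSemidef) : 1 ≤ (1 + A).det := by
  have hH : (1 + A).IsHermitian := isHermitian_one.add hA.isHermitian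
  have hev : ∀ i, 1 ≤ hH.eigenvalues i := fun i ↦ by
    rw [hH.eigenvalues_eq, add_mulVec, one_mulVec, dotProduct_add]
    have h1 := (Complex.le_def.1 (hA.dotProduct_mulVec_nonneg (hH.eigenvectorBasis i).ofLp)).1
    have h2 : star (hH.eigenvectorBasis i).ofLp ⬝ᵥ (hH.eigenvectorBasis i).ofLp = 1 := by
      have := inner_self_eq_norm_sq_to_K (𝕜 := ℂ) (hH.eigenvectorBasis i)
      rw [hH.eigenvectorBasis.orthonormal.1 i, EuclideanSpace.inner_eq_star_dotProduct] at this
      rw [dotProduct_comm]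
      simpa using this
    rw [h2]
    simpa using h1
  rw [hH.det_eq_prod_eigenvalues]
  have h := Finset.prod_induction hH.eigenvalues (1 ≤ ·)
    (fun _ _ ↦ one_le_mul_of_one_le_of_one_le) le_rfl fun i (_ : i ∈ Finset.univ) ↦ hev i
  simpa using (RCLike.ofReal_le_ofReal (K := ℂ)).2 h

open scoped MatrixOrder in
lemma PosDef.det_le_det_add {m : Type*} [Fintype m] [DecidableEq m]
    {A B : Matrix m m ℂ} (hA : A.PosDef) (hB : B.PosSemidef) : A.det ≤ (A + B).det := by
  obtain ⟨C, rfl⟩ := CStarAlgebra.nonneg_iff_eq_star_mul_self.1 hB.nonneg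
  rw [star_eq_conjTranspose] at hB ⊢
  rw [det_add_mul _ _ ((isUnit_iff_isUnit_det A).1 hA.isUnit)]
  exact le_mul_of_one_le_right hA.det_pos.le
    (hA.inv.posSemidef.mul_mul_conjTranspose_same C).one_le_det_one_add

lemma PosDef.schur_complement {m n : Type*} [Fintype m] [Fintype n] [DecidableEq m]
    [DecidableEq n] {A : Matrix m m ℂ} {B : Matrix m n ℂ} {D : Matrix n n ℂ}
    (h : (fromBlocks A B Bᴴ D).PosDef) : (D - Bᴴ * A⁻¹ * B).PosDef := by
  have hA : A.PosDef := h.submatrix (e := Sum.inl) Sum.inl_injective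
  have := hA.isUnit.invertible
  have hS := (PosDef.fromBlocks₁₁ B D hA).1 h.posSemidef
  rw [hS.posDef_iff_det_ne_zero]
  have h0 := h.det_pos.ne'
  rw [det_fromBlocks₁₁, invOf_eq_nonsing_inv] at h0
  exact right_ne_zero_of_mul h0

/-- The Fischer inequality. -/
lemma PosDef.det_fromBlocks_le {m n : Type*} [Fintype m] [Fintype n] [DecidableEq m]
    [DecidableEq n] {A : Matrix m m ℂ} {B : Matrix m n ℂ} {D : Matrix n n ℂ}
    (h : (fromBlocks A B Bᴴ D).PosDef) : (fromBlocks A B Bᴴ D).det ≤ A.det * D.det := by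
  have hA : A.PosDef := h.submatrix (e := Sum.inl) Sum.inl_injective
  have := hA.isUnit.invertible
  rw [det_fromBlocks₁₁, invOf_eq_nonsing_inv]
  refine mul_le_mul_of_nonneg_left ?_ hA.det_pos.le
  simpa using h.schur_complement.det_le_det_add
    (hA.inv.posSemidef.conjTranspose_mul_mul_same B)

lemma PosDef.det_le_mul_det_submatrix {m n : Type*} [Fintype m] [Fintype n] [DecidableEq m]
    [DecidableEq n] {M : Matrix (m ⊕ n) (m ⊕ n) ℂ} (h : M.PosDef) :
    M.det ≤ (M.submatrix Sum.inl Sum.inl).det * (M.submatrix Sum.inr Sum.inr).det := by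
  have hM : M = fromBlocks M.toBlocks₁₁ M.toBlocks₁₂ M.toBlocks₁₂ᴴ M.toBlocks₂₂ := by
    conv_lhs => rw [← fromBlocks_toBlocks M]
    congr 1
    ext i j
    exact (h.isHermitian.apply _ _).symm
  rw [hM] at h
  have := h.det_fromBlocks_le
  rw [← hM] at this
  exact this

lemma PosDef.det_submatrix_map_id {m n k : Type*} [Fintype m] [Fintype n] [Fintype k]
    [DecidableEq m] [DecidableEq n] [DecidableEq k] {A : Matrix m m ℂ} {B : Matrix m n ℂ}
    {D : Matrix n n ℂ} (h : (fromBlocks A B Bᴴ D).PosDef) (f : k → n) :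
    ((fromBlocks A B Bᴴ D).submatrix (Sum.map id f) (Sum.map id f)).det =
      A.det * ((D - Bᴴ * A⁻¹ * B).submatrix f f).det := by
  have hA : A.PosDef := h.submatrix (e := Sum.inl) Sum.inl_injective
  have := hA.isUnit.invertible
  have hb : (fromBlocks A B Bᴴ D).submatrix (Sum.map id f) (Sum.map id f) =
      fromBlocks A (B.submatrix id f) (Bᴴ.submatrix f id) (D.submatrix f f) := by
    ext (i | i) (j | j) <;> rfl
  rw [hb, det_fromBlocks₁₁, invOf_eq_nonsing_inv]
  rfl

/-- The Hadamard–Fischer–Koteljanskii inequality, in block form. -/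
lemma PosDef.det_mul_det_submatrix_le_sum {c a b : Type*} [Fintype c] [Fintype a] [Fintype b]
    [DecidableEq c] [DecidableEq a] [DecidableEq b]
    {M : Matrix (c ⊕ (a ⊕ b)) (c ⊕ (a ⊕ b)) ℂ} (h : M.PosDef) :
    M.det * (M.submatrix Sum.inl Sum.inl).det ≤
      (M.submatrix (Sum.map id Sum.inl) (Sum.map id Sum.inl)).det *
        (M.submatrix (Sum.map id Sum.inr) (Sum.map id Sum.inr)).det := by
  have hM : M = fromBlocks M.toBlocks₁₁ M.toBlocks₁₂ M.toBlocks₁₂ᴴ M.toBlocks₂₂ := by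
    conv_lhs => rw [← fromBlocks_toBlocks M]
    congr 1
    ext i j
    exact (h.isHermitian.apply _ _).symm
  generalize M.toBlocks₁₁ = C, M.toBlocks₁₂ = B, M.toBlocks₂₂ = D at hM
  subst hM
  have hC : C.PosDef := h.submatrix (e := Sum.inl) Sum.inl_injective
  have := hC.isUnit.invertible
  have hS := h.schur_complement
  have h1 : (fromBlocks C B Bᴴ D).det = C.det * (D - Bᴴ * C⁻¹ * B).det := by
    rw [det_fromBlocks₁₁, invOf_eq_nonsing_inv]
  have h2 : ((fromBlocks C B Bᴴ D).submatrix Sum.inl Sum.inl) = C := rfl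
  rw [h.det_submatrix_map_id, h.det_submatrix_map_id, h1, h2]
  calc _ = C.det * C.det * (D - Bᴴ * C⁻¹ * B).det := by ring
    _ ≤ C.det * C.det * _ :=
      mul_le_mul_of_nonneg_left hS.det_le_mul_det_submatrix
        (mul_nonneg hC.det_pos.le hC.det_pos.le)
    _ = _ := by ring

/-- The matrix that agrees with `M` on `X × X` and with the identity elsewhere. -/
noncomputable def extendByOne {n : Type*} [DecidableEq n] (M : Matrix n n ℂ) (X : Set n) :
    Matrix n n ℂ :=
  of fun i j ↦ if i ∈ X ∧ j ∈ X then M i j else (1 : Matrix n n ℂ) i j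

lemma det_extendByOne_range {m n : Type*} [Fintype m] [Fintype n] [DecidableEq m]
    [DecidableEq n] (M : Matrix n n ℂ) {f : m → n} (hf : f.Injective) :
    (M.extendByOne (Set.range f)).det = (M.submatrix f f).det := by
  rw [twoBlockTriangular_det _ (· ∈ Set.range f)]
  · have h1 : toSquareBlockProp (M.extendByOne (Set.range f)) (fun i ↦ i ∉ Set.range f) = 1 := by
      ext ⟨i, hi⟩ ⟨j, hj⟩
      simp only [toSquareBlockProp_def, extendByOne, of_apply, if_neg fun h : _ ∧ _ ↦ hi h.1]
      simp [one_apply]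
    rw [h1, det_one, mul_one]
    have h2 : M.submatrix f f =
        (toSquareBlockProp (M.extendByOne (Set.range f)) (· ∈ Set.range f)).submatrix
          (Equiv.ofInjective f hf) (Equiv.ofInjective f hf) := by
      ext i j
      simp [toSquareBlockProp_def, extendByOne]
    rw [h2]
    convert! (det_submatrix_equiv_self (Equiv.ofInjective f hf) _).symm
  · rintro i hi j hj
    have : i ≠ j := by rintro rfl; exact hi hj
    simp only [extendByOne, of_apply, if_neg fun h : _ ∧ _ ↦ hi h.1, one_apply_ne this]

/-- The Hadamard–Fischer–Koteljanskii inequality. -/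
lemma PosDef.det_extendByOne_union_mul_inter_le {n : Type*} [Fintype n] [DecidableEq n]
    {M : Matrix n n ℂ} (h : M.PosDef) (X Y : Set n) :
    (M.extendByOne (X ∪ Y)).det * (M.extendByOne (X ∩ Y)).det ≤
      (M.extendByOne X).det * (M.extendByOne Y).det := by
  let f : ↥(X ∩ Y) ⊕ (↥(X \ Y) ⊕ ↥(Y \ X)) → n :=
    Sum.elim Subtype.val (Sum.elim Subtype.val Subtype.val)
  have hf : f.Injective := by
    rintro (⟨i, hi⟩ | ⟨i, hi⟩ | ⟨i, hi⟩) (⟨j, hj⟩ | ⟨j, hj⟩ | ⟨j, hj⟩) hij <;>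
      obtain rfl : i = j := hij <;>
        first | rfl | (simp only [Set.mem_inter_iff, Set.mem_sdiff] at hi hj; tauto)
  have hX : X = Set.range (f ∘ Sum.map id Sum.inl) := by
    ext i; simp [f]; tauto
  have hY : Y = Set.range (f ∘ Sum.map id Sum.inr) := by
    ext i; simp [f]; tauto
  have hU : X ∪ Y = Set.range f := by
    ext i; simp [f]; tauto
  have hI : X ∩ Y = Set.range (f ∘ Sum.inl) := by
    ext i; simp [f]
  have key := (h.submatrix hf).det_mul_det_submatrix_le_sum
  rw [hU, congrArg (fun Z ↦ (M.extendByOne Z).det) hI, det_extendByOne_range M hf,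
    det_extendByOne_range M (hf.comp Sum.inl_injective),
    congrArg (fun Z ↦ (M.extendByOne Z).det) hX, congrArg (fun Z ↦ (M.extendByOne Z).det) hY,
    det_extendByOne_range M (hf.comp (Function.injective_id.sumMap Sum.inl_injective)),
    det_extendByOne_range M (hf.comp (Function.injective_id.sumMap Sum.inr_injective))]
  exact key

/-- The matrix that agrees with `N` on the rows `B` and the columns `A` and vanishes elsewhere. -/
noncomputable def restrictTo {r t : Type*} (N : Matrix r t ℂ) (A : Set t) (B : Set r) :
    Matrix r t ℂ :=
  of fun i j ↦ if i ∈ B ∧ j ∈ A then N i j else 0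

/-- The covariance matrix of the input and the output of the Gaussian channel `N`. -/
def jointCovariance {r t : Type*} [Fintype t] [DecidableEq r] [DecidableEq t]
    (N : Matrix r t ℂ) : Matrix (t ⊕ r) (t ⊕ r) ℂ :=
  fromBlocks 1 Nᴴ N (1 + N * Nᴴ)

lemma posDef_jointCovariance {r t : Type*} [Fintype r] [Fintype t] [DecidableEq r]
    [DecidableEq t] (N : Matrix r t ℂ) : N.jointCovariance.PosDef := by
  have h : N.jointCovariance = fromBlocks 1 0 N 1 * (fromBlocks 1 0 N 1)ᴴ := by
    simp [jointCovariance, fromBlocks_conjTranspose, fromBlocks_multiply, add_comm]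
  rw [h, (posSemidef_self_mul_conjTranspose _).posDef_iff_det_ne_zero, det_mul,
    det_conjTranspose, det_fromBlocks_zero₁₂]
  simp

lemma det_extendByOne_jointCovariance {r t : Type*} [Fintype r] [Fintype t] [DecidableEq r]
    [DecidableEq t] (N : Matrix r t ℂ) (A : Set t) (B : Set r) :
    (N.jointCovariance.extendByOne {x | x.elim (· ∉ A) (· ∈ B)}).det =
      (1 + N.restrictTo A B * (N.restrictTo A B)ᴴ).det := by
  have h : N.jointCovariance.extendByOne {x | x.elim (· ∉ A) (· ∈ B)} =
      fromBlocks 1 (N.restrictTo Aᶜ B)ᴴ (N.restrictTo Aᶜ B)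
        (1 + N.restrictTo Set.univ B * (N.restrictTo Set.univ B)ᴴ) := by
    ext (i | i) (j | j)
    · by_cases i = j <;> simp_all [extendByOne, jointCovariance, one_apply]
    · by_cases i ∈ A <;> by_cases j ∈ B <;>
        simp_all [extendByOne, jointCovariance, restrictTo]
    · by_cases j ∈ A <;> by_cases i ∈ B <;>
        simp_all [extendByOne, jointCovariance, restrictTo]
    · by_cases i ∈ B <;> by_cases j ∈ B <;>
        simp_all [extendByOne, jointCovariance, restrictTo, mul_apply, one_apply]
  have h' : N.restrictTo Set.univ B * (N.restrictTo Set.univ B)ᴴ =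
      N.restrictTo A B * (N.restrictTo A B)ᴴ + N.restrictTo Aᶜ B * (N.restrictTo Aᶜ B)ᴴ := by
    ext i j
    simp only [mul_apply, add_apply, ← Finset.sum_add_distrib]
    refine Finset.sum_congr rfl fun k _ ↦ ?_
    by_cases k ∈ A <;> simp [restrictTo, *]
  rw [h, det_fromBlocks_one₁₁, h']
  congr 1
  abel

/-- The mutual information between the input and the output of the Gaussian channel `N`. -/
noncomputable def gaussianInfo {r t : Type*} [Fintype r] [Fintype t] [DecidableEq r]
    (N : Matrix r t ℂ) : ℝ :=
  Real.log (1 + N * Nᴴ).det.re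

section gaussianInfo

variable {r t : Type*} [Fintype r] [Fintype t] [DecidableEq r]

lemma one_le_det_one_add_mul_conjTranspose (N : Matrix r t ℂ) : 1 ≤ (1 + N * Nᴴ).det :=
  (posSemidef_self_mul_conjTranspose N).one_le_det_one_add

lemma gaussianInfo_nonneg (N : Matrix r t ℂ) : 0 ≤ N.gaussianInfo :=
  Real.log_nonneg (Complex.le_def.1 N.one_le_det_one_add_mul_conjTranspose).1

@[simp] lemma gaussianInfo_zero : (0 : Matrix r t ℂ).gaussianInfo = 0 := by
  simp [gaussianInfo]

lemma gaussianInfo_add_le_of_det_mul_le {N₁ N₂ N₃ N₄ : Matrix r t ℂ}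
    (h : (1 + N₁ * N₁ᴴ).det * (1 + N₂ * N₂ᴴ).det ≤ (1 + N₃ * N₃ᴴ).det * (1 + N₄ * N₄ᴴ).det) :
    N₁.gaussianInfo + N₂.gaussianInfo ≤ N₃.gaussianInfo + N₄.gaussianInfo := by
  have hre := fun N : Matrix r t ℂ ↦
    zero_lt_one.trans_le (Complex.le_def.1 N.one_le_det_one_add_mul_conjTranspose).1
  have him := fun N : Matrix r t ℂ ↦
    (Complex.le_def.1 N.one_le_det_one_add_mul_conjTranspose).2
  have h' := (Complex.le_def.1 h).1
  simp only [Complex.mul_re, ← him, Complex.one_im, mul_zero, sub_zero] at h'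
  simp only [gaussianInfo]
  rw [← Real.log_mul (hre _).ne' (hre _).ne', ← Real.log_mul (hre _).ne' (hre _).ne']
  exact Real.log_le_log (mul_pos (hre _) (hre _)) h'

lemma gaussianInfo_restrictTo_submodular (N : Matrix r t ℂ) (A A' : Set t) (B B' : Set r) :
    (N.restrictTo (A ∩ A') (B ∪ B')).gaussianInfo +
        (N.restrictTo (A ∪ A') (B ∩ B')).gaussianInfo ≤
      (N.restrictTo A B).gaussianInfo + (N.restrictTo A' B').gaussianInfo := by
  apply gaussianInfo_add_le_of_det_mul_le
  simp only [← det_extendByOne_jointCovariance]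
  convert! N.posDef_jointCovariance.det_extendByOne_union_mul_inter_le
    {x | x.elim (· ∉ A) (· ∈ B)} {x | x.elim (· ∉ A') (· ∈ B')} using 4
  · ext (i | i) <;> simp
    tauto
  · ext (i | i) <;> simp

end gaussianInfo

end Matrix

/-- The channel matrix `H`, scaled by the transmit amplitudes and restricted to the edges `F`. -/
noncomputable def edgeMatrix {V T Rx : Type*} (τ : T → V) (ρ : Rx → V) (H : Matrix Rx T ℂ)
    (p : T → ℝ) (F : Set (V × V)) : Matrix Rx T ℂ :=
  of fun r t ↦ if (τ t, ρ r) ∈ F then H r t * (√(p t) : ℝ) else 0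

lemma edgeMatrix_inter_prod {V T Rx : Type*} (τ : T → V) (ρ : Rx → V) (H : Matrix Rx T ℂ)
    (p : T → ℝ) (F : Set (V × V)) (A B : Set V) :
    edgeMatrix τ ρ H p (F ∩ A ×ˢ B) =
      (edgeMatrix τ ρ H p F).restrictTo (τ ⁻¹' A) (ρ ⁻¹' B) := by
  ext r t
  simp only [edgeMatrix, restrictTo, of_apply, Set.mem_inter_iff, Set.mem_prod, Set.mem_preimage,
    ← ite_and]
  congr 1
  exact propext (by tauto)

lemma cutValue_subnetwork {V T Rx : Type*} [Fintype T] [Fintype Rx] (τ : T → V) (ρ : Rx → V)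
    (H : Matrix Rx T ℂ) {p : T → ℝ} (hp : ∀ t, 0 ≤ p t) (E : Set (V × V)) (S : Set V) :
    cutValue τ ρ (subnetwork τ ρ H E) p S =
      (edgeMatrix τ ρ H p (E ∩ S ×ˢ Sᶜ)).gaussianInfo := by
  have hsqrt : ∀ t, ((√(p t) : ℝ) : ℂ) * (√(p t) : ℝ) = p t := fun t ↦ by
    rw [← Complex.ofReal_mul, Real.mul_self_sqrt (hp t)]
  set N := edgeMatrix τ ρ H p (E ∩ S ×ˢ Sᶜ) with hN
  have hN0 : ∀ r t, ¬ (ρ r ∉ S) → N r t = 0 := fun r t hr ↦ by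
    simp [hN, edgeMatrix, not_not.1 hr]
  have hzero : ∀ i, ¬ (ρ i ∉ S) → ∀ j, (N * Nᴴ) i j = 0 := fun i hi j ↦ by
    simp [mul_apply, hN0 i _ hi]
  have h₁ : toSquareBlockProp (1 + N * Nᴴ) (fun r ↦ ρ r ∉ S) =
      1 + cutMatrix τ ρ (subnetwork τ ρ H E) S *
        diagonal (fun t : {t : T // τ t ∈ S} ↦ (p t.1 : ℂ)) *
        (cutMatrix τ ρ (subnetwork τ ρ H E) S)ᴴ := by
    ext ⟨i, hi⟩ ⟨j, hj⟩
    rw [toSquareBlockProp_def, of_apply, Matrix.add_apply, Matrix.add_apply]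
    congr 1
    · simp [one_apply]
    rw [mul_apply, mul_apply]
    simp only [mul_diagonal, conjTranspose_apply]
    refine Eq.trans ?_ (Finset.sum_subtype (p := (τ · ∈ S)) (Finset.univ.filter (τ · ∈ S))
      (by simp) fun t ↦ subnetwork τ ρ H E i t * p t * star (subnetwork τ ρ H E j t))
    rw [Finset.sum_filter]
    refine Finset.sum_congr rfl fun t _ ↦ ?_
    by_cases ht : τ t ∈ S <;> by_cases h₁ : (τ t, ρ i) ∈ E <;> by_cases h₂ : (τ t, ρ j) ∈ E <;>
      simp [hN, edgeMatrix, subnetwork, hi, hj, ht, h₁, h₂]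
    rw [← hsqrt]
    ring
  have h₂ : toSquareBlockProp (1 + N * Nᴴ) (fun r ↦ ¬ (ρ r ∉ S)) = 1 := by
    ext ⟨i, hi⟩ ⟨j, hj⟩
    rw [toSquareBlockProp_def, of_apply, Matrix.add_apply, hzero i hi j]
    simp [one_apply]
  rw [gaussianInfo, twoBlockTriangular_det _ (fun r ↦ ρ r ∉ S), h₁, h₂, det_one, mul_one, cutValue]
  intro i hi j hj
  rw [Matrix.add_apply, hzero i hi j, one_apply_ne (by rintro rfl; exact hi hj), add_zero]

namespace EdgeFlow

open scoped Topology

variable {V : Type*}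

/-- A set function on edges whose cut function `(A, B) ↦ μ (F ∩ A ×ˢ B)` is bisubmodular
for every edge set `F`, as for the capacity function of a linking system. -/
structure IsLinking (μ : Set (V × V) → ℝ) : Prop where
  empty : μ ∅ = 0
  nonneg : ∀ F, 0 ≤ μ F
  submodular : ∀ (F : Set (V × V)) (A A' B B' : Set V),
    μ (F ∩ (A ∩ A') ×ˢ (B ∪ B')) + μ (F ∩ (A ∪ A') ×ˢ (B ∩ B')) ≤
      μ (F ∩ A ×ˢ B) + μ (F ∩ A' ×ˢ B')

lemma IsLinking.mono_left {μ : Set (V × V) → ℝ} (hμ : IsLinking μ) (F : Set (V × V))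
    {A A' : Set V} (h : A' ⊆ A) (B : Set V) : μ (F ∩ A' ×ˢ B) ≤ μ (F ∩ A ×ˢ B) := by
  have := hμ.submodular F A A' B ∅
  rw [Set.inter_eq_self_of_subset_right h] at this
  simpa [hμ.empty] using this

variable [Fintype V]

/-- The total weight of `S` under the weights `x`. -/
noncomputable def mass (x : V → ℝ) (S : Set V) : ℝ :=
  ∑ v, S.indicator x v

lemma mass_inter_add_union (x : V → ℝ) (S S' : Set V) :
    mass x (S ∩ S') + mass x (S ∪ S') = mass x S + mass x S' := by
  simp only [mass, ← Finset.sum_add_distrib]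
  refine Finset.sum_congr rfl fun v _ ↦ ?_
  by_cases v ∈ S <;> by_cases v ∈ S' <;> simp [*]

lemma mass_add (x y : V → ℝ) (S : Set V) : mass (x + y) S = mass x S + mass y S := by
  simp [mass, Set.indicator_add', Finset.sum_add_distrib]

lemma mass_sub_smul (x y : V → ℝ) (a : ℝ) (S : Set V) :
    mass (x - a • y) S = mass x S - a * mass y S := by
  simp only [mass, Finset.mul_sum, ← Finset.sum_sub_distrib]
  refine Finset.sum_congr rfl fun v _ ↦ ?_
  by_cases v ∈ S <;> simp [*]

lemma mass_compl_add (x : V → ℝ) (S : Set V) : mass x Sᶜ + mass x S = mass x Set.univ := by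
  have := mass_inter_add_union x Sᶜ S
  simpa [mass] using this.symm

lemma mass_nonneg {x : V → ℝ} (hx : 0 ≤ x) (S : Set V) : 0 ≤ mass x S :=
  Finset.sum_nonneg fun v _ ↦ Set.indicator_nonneg (fun v _ ↦ hx v) v

lemma mass_inter_add_sdiff (x : V → ℝ) (S S' : Set V) :
    mass x (S ∩ S') + mass x (S \ S') = mass x S := by
  simp only [mass, ← Finset.sum_add_distrib]
  refine Finset.sum_congr rfl fun v _ ↦ ?_
  by_cases v ∈ S <;> by_cases v ∈ S' <;> simp [*]

lemma mass_diff_singleton {x : V → ℝ} {u : V} (hu : x u = 0) (S : Set V) :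
    mass x (S \ {u}) = mass x S := by
  refine Finset.sum_congr rfl fun v _ ↦ ?_
  by_cases h : v = u
  · subst h; by_cases v ∈ S <;> simp [*]
  · by_cases v ∈ S <;> simp [*]

lemma mass_single (s : V) (a : ℝ) (S : Set V) :
    mass (Pi.single s a) S = if s ∈ S then a else 0 := by
  rw [mass, Finset.sum_eq_single s]
  · simp [Set.indicator_apply]
  · intro v _ hv; simp [Set.indicator_apply, hv]
  · simp

lemma one_le_mass {v : V} {S : Set V} (hv : v ∈ S) : 1 ≤ mass (1 : V → ℝ) S := by
  calc (1 : ℝ) = mass (Pi.single v 1) S := by simp [mass_single, hv]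
    _ ≤ mass 1 S := Finset.sum_le_sum fun u _ ↦ by
      by_cases u = v <;> by_cases u ∈ S <;> simp [*]

lemma continuous_mass (S : Set V) : Continuous fun x : V → ℝ ↦ mass x S := by
  simp only [mass, Set.indicator_apply]
  refine continuous_finsetSum _ fun v _ ↦ ?_
  split_ifs <;> fun_prop

/-- The edge set `E` with capacities `μ` can carry a flow in which node `v` emits `x v` and
receives `y v`. -/
def Supports (μ : Set (V × V) → ℝ) (E : Set (V × V)) (x y : V → ℝ) : Prop :=
  ∀ A B : Set V, mass x A ≤ mass y Bᶜ + μ (E ∩ A ×ˢ B)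

variable {μ : Set (V × V) → ℝ} {E : Set (V × V)} {x y : V → ℝ}

lemma Supports.diff_of_tight (hμ : IsLinking μ) (h : Supports μ E x y) {A B : Set V}
    (ht : mass x A = mass y Bᶜ + μ (E ∩ A ×ˢ B)) : Supports μ (E \ Aᶜ ×ˢ Bᶜ) x y := by
  intro A' B'
  have hsub := hμ.submodular (E \ Aᶜ ×ˢ Bᶜ) A' A B' B
  have e₁ : (E \ Aᶜ ×ˢ Bᶜ) ∩ (A' ∩ A) ×ˢ (B' ∪ B) = E ∩ (A' ∩ A) ×ˢ (B' ∪ B) := by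
    ext; simp; tauto
  have e₂ : (E \ Aᶜ ×ˢ Bᶜ) ∩ (A' ∪ A) ×ˢ (B' ∩ B) = E ∩ (A' ∪ A) ×ˢ (B' ∩ B) := by
    ext; simp; tauto
  have e₃ : (E \ Aᶜ ×ˢ Bᶜ) ∩ A ×ˢ B = E ∩ A ×ˢ B := by
    ext; simp; tauto
  rw [e₁, e₂, e₃] at hsub
  have h₁ := h (A' ∩ A) (B' ∪ B)
  have h₂ := h (A' ∪ A) (B' ∩ B)
  have hx := mass_inter_add_union x A' A
  have hy := mass_inter_add_union y B'ᶜ Bᶜ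
  rw [← Set.compl_union, ← Set.compl_inter] at hy
  linarith

lemma Supports.diff_source (h : Supports μ E x y) {u : V} (hu : x u = 0) :
    Supports μ (E \ {u} ×ˢ Set.univ) x y := by
  intro A B
  have e : (E \ {u} ×ˢ Set.univ) ∩ A ×ˢ B = E ∩ (A \ {u}) ×ˢ B := by
    ext; simp; tauto
  rw [e, ← mass_diff_singleton hu]
  exact h _ _

lemma Supports.diff_target (h : Supports μ E x y) {u : V} (hu : y u = 0) :
    Supports μ (E \ Set.univ ×ˢ {u}) x y := by
  intro A B
  have e : (E \ Set.univ ×ˢ {u}) ∩ A ×ˢ B = E ∩ A ×ˢ (B \ {u}) := by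
    ext; simp; tauto
  have := h A (B \ {u})
  have hB : (B \ {u})ᶜ \ {u} = Bᶜ \ {u} := by ext; simp; tauto
  rwa [e, ← mass_diff_singleton hu Bᶜ, ← hB, mass_diff_singleton hu]

/-- A closed walk in `E` yields nonnegative weights (the visit counts), not all zero, that are
carried by nodes with incoming and outgoing edges, and that satisfy the cut condition
across every pair `(A, B)` such that `E` has no edge from `Aᶜ` to `Bᶜ`. -/
lemma exists_weights_of_transGen {u w : V} (h : Relation.TransGen (fun a b ↦ (a, b) ∈ E) u w) :
    ∃ c : V → ℝ, 0 ≤ c ∧ 0 < c u ∧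
      (∀ v, c v ≠ 0 → (∃ b, (v, b) ∈ E) ∧ (v = u ∨ ∃ a, (a, v) ∈ E)) ∧
      ∀ A B : Set V, (∀ a b, (a, b) ∈ E → b ∉ B → a ∈ A) →
        mass c Bᶜ + mass (Pi.single w 1) Bᶜ ≤ mass (Pi.single u 1) Bᶜ + mass c A := by
  induction h with
  | @single b hb =>
    refine ⟨Pi.single u 1, ?_, by simp, fun v hv ↦ ?_, fun A B hAB ↦ ?_⟩
    · simp
    · obtain rfl : v = u := by by_contra h; simp [h] at hv
      exact ⟨⟨b, hb⟩, .inl rfl⟩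
    · have := hAB u b hb
      simp only [mass_single, Set.mem_compl_iff]
      split_ifs <;> simp_all
  | @tail b d hub hb ih =>
    obtain ⟨c, hc, hcu, hE, hcut⟩ := ih
    have h1 : (0 : V → ℝ) ≤ Pi.single b 1 := by simp
    refine ⟨c + Pi.single b 1, add_nonneg hc h1, add_pos_of_pos_of_nonneg hcu (h1 u),
      fun v hv ↦ ?_, fun A B hAB ↦ ?_⟩
    · by_cases hvb : v = b
      · subst hvb
        obtain ⟨a, -, ha⟩ := Relation.TransGen.tail'_iff.1 hub
        exact ⟨⟨d, hb⟩, .inr ⟨a, ha⟩⟩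
      · exact hE v (by simpa [hvb] using hv)
    · have h2 := hcut A B hAB
      have h3 : mass (Pi.single d 1) Bᶜ ≤ mass (Pi.single b 1) A := by
        have := hAB b d hb
        simp only [mass_single, Set.mem_compl_iff]
        split_ifs <;> simp_all
      rw [mass_add, mass_add]
      linarith

lemma exists_circulation_of_not_acyclic (h : ¬ AcyclicEdgeSet E) :
    ∃ c : V → ℝ, 0 ≤ c ∧ (∃ u, 0 < c u) ∧
      (∀ v, c v ≠ 0 → (∃ b, (v, b) ∈ E) ∧ ∃ a, (a, v) ∈ E) ∧
      ∀ A B : Set V, (∀ a b, (a, b) ∈ E → b ∉ B → a ∈ A) → mass c Bᶜ ≤ mass c A := by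
  obtain ⟨u, hu⟩ : ∃ u, Relation.TransGen (fun a b ↦ (a, b) ∈ E) u u := by
    by_contra! hne
    exact h hne
  obtain ⟨c, hc, hcu, hE, hcut⟩ := exists_weights_of_transGen hu
  refine ⟨c, hc, ⟨u, hcu⟩, fun v hv ↦ ⟨(hE v hv).1, (hE v hv).2.elim ?_ id⟩, fun A B hAB ↦ ?_⟩
  · rintro rfl
    obtain ⟨a, -, ha⟩ := Relation.TransGen.tail'_iff.1 hu
    exact ⟨a, ha⟩
  · linarith [hcut A B hAB]

/-- A flow that can be supported at all can be supported, after rerouting circulations, by an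
acyclic edge set. -/
lemma exists_acyclic_supports (hμ : IsLinking μ) {s : V} {r : ℝ} {w z : V → ℝ}
    (hw : w s = 0) (hz : 0 ≤ z) (h : Supports μ E (z + Pi.single s r) (z + w)) :
    ∃ E' : Set (V × V), AcyclicEdgeSet E' ∧
      ∃ z : V → ℝ, Supports μ E' (z + Pi.single s r) (z + w) := by
  obtain ⟨E, ⟨z₀, hz₀, hsupp⟩, hmin⟩ := exists_minimal_of_wellFoundedLT
    (fun E : Set (V × V) ↦ ∃ z : V → ℝ, 0 ≤ z ∧ Supports μ E (z + Pi.single s r) (z + w))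
    ⟨E, z, hz, h⟩
  refine ⟨E, ?_, z₀, hsupp⟩
  by_contra hcyc
  obtain ⟨c, hc, ⟨u, hu⟩, hE, hcut⟩ := exists_circulation_of_not_acyclic hcyc
  have hred : ∀ z : V → ℝ, 0 ≤ z → ∀ D, Supports μ (E \ D) (z + Pi.single s r) (z + w) →
      ∀ e ∈ E, e ∉ D := fun z hz D hD e he heD ↦ (hmin ⟨z, hz, hD⟩ Set.sdiff_subset he).2 heD
  have hpos : ∀ z : V → ℝ, 0 ≤ z → Supports μ E (z + Pi.single s r) (z + w) →
      ∀ v, c v ≠ 0 → 0 < z v := by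
    intro z hz hsupp v hv
    refine (hz v).lt_of_ne fun h0 ↦ ?_
    obtain ⟨⟨b, hb⟩, a, ha⟩ := hE v hv
    by_cases hvs : v = s
    · exact hred z hz _ (hsupp.diff_target (u := v) (by subst hvs; simpa [hw] using h0.symm)) _ ha (by simp)
    · exact hred z hz _ (hsupp.diff_source (u := v) (by simp [← h0, hvs])) _ hb (by simp)
  let K : Set (V → ℝ) := Set.Icc 0 z₀ ∩ {z | Supports μ E (z + Pi.single s r) (z + w)}
  have hK : IsCompact K := by
    refine isCompact_Icc.inter_right ?_
    simp only [Supports, Set.ofPred_forall]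
    refine isClosed_iInter fun A ↦ isClosed_iInter fun B ↦ isClosed_le ?_ ?_
    · exact (continuous_mass A).comp (by fun_prop)
    · exact ((continuous_mass Bᶜ).comp (by fun_prop)).add continuous_const
  obtain ⟨z, ⟨hzI, hzs⟩, hzmin⟩ := hK.exists_isMinOn ⟨z₀, ⟨hz₀, le_rfl⟩, hsupp⟩
    (continuous_mass (Set.univ)).continuousOn
  have hev : ∀ᶠ ε in 𝓝[>] (0 : ℝ), z - ε • c ∈ K := by
    have hcoord : ∀ᶠ ε in 𝓝[>] (0 : ℝ), ∀ v, 0 ≤ (z - ε • c) v := by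
      refine Filter.eventually_all.2 fun v ↦ ?_
      by_cases hv : c v = 0
      · exact .of_forall fun ε ↦ by simpa [hv] using hzI.1 v
      · have : Filter.Tendsto (fun ε : ℝ ↦ (z - ε • c) v) (𝓝 0) (𝓝 (z v)) := by
          have : Continuous fun ε : ℝ ↦ (z - ε • c) v := by simp; fun_prop
          simpa using this.tendsto 0
        exact ((this.mono_left nhdsWithin_le_nhds).eventually_const_lt
          (hpos z hzI.1 hzs v hv)).mono fun _ ↦ le_of_lt
    have hsup : ∀ᶠ ε in 𝓝[>] (0 : ℝ),
        Supports μ E ((z - ε • c) + Pi.single s r) ((z - ε • c) + w) := by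
      refine Filter.eventually_all.2 fun A ↦ Filter.eventually_all.2 fun B ↦ ?_
      simp only [mass_add, mass_sub_smul]
      have hAB := hzs A B
      rw [mass_add, mass_add] at hAB
      rcases hAB.eq_or_lt with ht | hlt
      · have hle := hcut A B fun a b hab hb ↦ by
          by_contra ha
          exact hred z hzI.1 _ (hzs.diff_of_tight hμ (by rwa [mass_add, mass_add])) _ hab
            ⟨ha, hb⟩
        filter_upwards [self_mem_nhdsWithin] with ε hε
        have := mul_le_mul_of_nonneg_left hle (le_of_lt hε)
        linarith
      · have h1 : Continuous fun ε : ℝ ↦ mass z A - ε * mass c A + mass (Pi.single s r) A := by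
          fun_prop
        have h2 : Continuous fun ε : ℝ ↦
            mass z Bᶜ - ε * mass c Bᶜ + mass w Bᶜ + μ (E ∩ A ×ˢ B) := by
          fun_prop
        have := h1.continuousAt.eventually_lt h2.continuousAt (x₀ := 0) (by simpa using hlt)
        exact (this.filter_mono nhdsWithin_le_nhds).mono fun _ ↦ le_of_lt
    filter_upwards [hcoord, hsup, self_mem_nhdsWithin] with ε h1 h2 hε
    refine ⟨⟨h1, ?_⟩, h2⟩
    exact (sub_le_self _ (smul_nonneg (le_of_lt hε) hc)).trans hzI.2
  obtain ⟨ε, hεK, hε⟩ := (hev.and self_mem_nhdsWithin).exists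
  have h1 := hzmin hεK
  simp only [Set.mem_ofPred_eq, mass_sub_smul] at h1
  have h2 : 0 < mass c Set.univ := by
    simp only [mass, Set.indicator_univ]
    exact Finset.sum_pos' (fun v _ ↦ hc v) ⟨u, Finset.mem_univ _, hu⟩
  have := mul_pos hε h2
  linarith

/-- Adding self-loops of capacity `K` preserves the linking property. -/
lemma IsLinking.add_loops (hμ : IsLinking μ) {K : ℝ} (hK : 0 ≤ K) :
    IsLinking fun F ↦ μ F + K * mass 1 {v | (v, v) ∈ F} where
  empty := by simp [hμ.empty, mass]
  nonneg F := add_nonneg (hμ.nonneg F) (mul_nonneg hK (mass_nonneg zero_le_one _))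
  submodular F A A' B B' := by
    have h : mass (1 : V → ℝ) {v | (v, v) ∈ F ∩ (A ∩ A') ×ˢ (B ∪ B')} +
        mass (1 : V → ℝ) {v | (v, v) ∈ F ∩ (A ∪ A') ×ˢ (B ∩ B')} ≤
        mass (1 : V → ℝ) {v | (v, v) ∈ F ∩ A ×ˢ B} +
        mass (1 : V → ℝ) {v | (v, v) ∈ F ∩ A' ×ˢ B'} := by
      simp only [mass, ← Finset.sum_add_distrib]
      refine Finset.sum_le_sum fun v _ ↦ ?_
      by_cases (v, v) ∈ F <;> by_cases v ∈ A <;> by_cases v ∈ A' <;> by_cases v ∈ B <;>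
        by_cases v ∈ B' <;> simp [*]
    nlinarith [hμ.submodular F A A' B B', mul_le_mul_of_nonneg_left h hK]

/-- Multicast demands `w` that satisfy the cut conditions from `s` in the complete edge set
satisfy them in some acyclic edge set. -/
theorem exists_acyclic_of_cut_le (hμ : IsLinking μ) (s : V) {w : V → ℝ} (hw : 0 ≤ w)
    (hws : w s = 0) (hcut : ∀ S : Set V, s ∈ S → mass w Sᶜ ≤ μ (Set.univ ∩ S ×ˢ Sᶜ)) :
    ∃ E : Set (V × V), AcyclicEdgeSet E ∧
      ∀ S : Set V, s ∈ S → mass w Sᶜ ≤ μ (E ∩ S ×ˢ Sᶜ) := by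
  set r := mass w Set.univ
  have hr : 0 ≤ r := mass_nonneg hw _
  have hstart : Supports (fun F ↦ μ F + (r + r) * mass 1 {v | (v, v) ∈ F}) Set.univ
      ((r • 1 : V → ℝ) + Pi.single s r) (r • 1 + w) := by
    intro A B
    have hsmul : ∀ S : Set V, mass (r • 1 : V → ℝ) S = r * mass 1 S := fun S ↦ by
      simp only [mass, Finset.mul_sum]
      refine Finset.sum_congr rfl fun v _ ↦ ?_
      by_cases v ∈ S <;> simp [*]
    have hloops : {v | (v, v) ∈ Set.univ ∩ A ×ˢ B} = A ∩ B := by ext; simp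
    have hpos : ∀ S : Set V, 0 ≤ r * mass 1 S := fun S ↦
      mul_nonneg hr (mass_nonneg zero_le_one S)
    have hone : ∀ v, ∀ S : Set V, v ∈ S → r ≤ r * mass 1 S := fun v S hv ↦
      le_mul_of_one_le_right hr (one_le_mass hv)
    have hA := congrArg (r * ·) (mass_inter_add_sdiff 1 A B)
    have hB := congrArg (r * ·) (mass_inter_add_sdiff 1 Bᶜ A)
    rw [Set.inter_comm, ← Set.sdiff_eq] at hB
    simp only [mul_add] at hA hB
    have hwB := mass_nonneg hw Bᶜ
    have hμAB := hμ.nonneg (Set.univ ∩ A ×ˢ B)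
    simp only [mass_add, hsmul, mass_single, hloops]
    split_ifs with hsA
    · by_cases hsB : s ∈ B
      · linarith [hone s (A ∩ B) ⟨hsA, hsB⟩, hpos (Bᶜ \ A)]
      by_cases hBA : Bᶜ ⊆ A
      · have h₁ := hcut Bᶜ hsB
        rw [compl_compl] at h₁
        linarith [hμ.mono_left Set.univ hBA B, mass_compl_add w B, hpos (A ∩ B), hpos (Bᶜ \ A)]
      · obtain ⟨v, hv⟩ := Set.not_subset.1 hBA
        linarith [hone v (Bᶜ \ A) hv, hpos (A ∩ B)]
    · linarith [hpos (A ∩ B), hpos (Bᶜ \ A)]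
  obtain ⟨E, hE, z, hz⟩ := exists_acyclic_supports (hμ.add_loops (add_nonneg hr hr)) hws
    (smul_nonneg hr zero_le_one) hstart
  refine ⟨E, hE, fun S hS ↦ ?_⟩
  have hSc := hz S Sᶜ
  have hloops : {v | (v, v) ∈ E ∩ S ×ˢ Sᶜ} = ∅ := by ext v; simp
  have hempty : mass (1 : V → ℝ) ∅ = 0 := by simp [mass]
  simp only [mass_add, mass_single, hS, if_true, compl_compl, hloops, hempty] at hSc
  linarith [mass_compl_add w S]

end EdgeFlow

lemma isLinking_gaussianInfo_edgeMatrix {V T Rx : Type*} [Fintype T] [Fintype Rx] (τ : T → V)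
    (ρ : Rx → V) (H : Matrix Rx T ℂ) (p : T → ℝ) :
    EdgeFlow.IsLinking fun F ↦ (edgeMatrix τ ρ H p F).gaussianInfo where
  empty := by
    have : edgeMatrix τ ρ H p ∅ = 0 := by ext; simp [edgeMatrix]
    simp [this]
  nonneg F := gaussianInfo_nonneg _
  submodular F A A' B B' := by
    simp only [edgeMatrix_inter_prod, Set.preimage_inter, Set.preimage_union]
    exact gaussianInfo_restrictTo_submodular ..

/-- (Broadcast.)  If the rate tuple `(R 1, …, R n)` lies in the
i.i.d.-evaluated cutset region of the Gaussian broadcast network with channel matrix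
`H`, source `s` and destinations `dst 1, …, dst n`, then it lies in the corresponding
region of some acyclic subnetwork of `H`. -/
theorem exists_acyclic_gaussian_subnetwork_broadcast
    {V T Rx : Type*} [Fintype V] [Fintype T] [Fintype Rx]
    (τ : T → V) (ρ : Rx → V) (H : Matrix Rx T ℂ) (p : T → ℝ) (hp : ∀ t, 0 ≤ p t)
    (n : ℕ) (s : V) (dst : Fin n → V) (hs : ∀ i, s ≠ dst i)
    (R : Fin n → ℝ) (hR : ∀ i, 0 ≤ R i)
    (hrate : ∀ S : Set V, s ∈ S →
      ∑ i ∈ Finset.univ.filter (fun i => dst i ∉ S), R i ≤ cutValue τ ρ H p S) :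
    ∃ E' : Set (V × V), AcyclicEdgeSet E' ∧
      ∀ S : Set V, s ∈ S →
        ∑ i ∈ Finset.univ.filter (fun i => dst i ∉ S), R i ≤
          cutValue τ ρ (subnetwork τ ρ H E') p S := by
  let w : V → ℝ := fun v ↦ ∑ i ∈ Finset.univ.filter (dst · = v), R i
  have hw : ∀ S : Set V, EdgeFlow.mass w Sᶜ =
      ∑ i ∈ Finset.univ.filter (fun i => dst i ∉ S), R i := fun S ↦ by
    simp only [EdgeFlow.mass, w, Set.indicator_apply, Finset.sum_filter]
    simp only [← Finset.sum_filter (fun v ↦ v ∈ Sᶜ)]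
    rw [Finset.sum_comm]
    simp
  have hw0 : 0 ≤ w := fun v ↦ Finset.sum_nonneg fun i _ ↦ hR i
  have hws : w s = 0 := Finset.sum_eq_zero fun i hi ↦ absurd (Finset.mem_filter.1 hi).2.symm (hs i)
  have huniv : subnetwork τ ρ H Set.univ = H := by ext; simp [subnetwork]
  obtain ⟨E, hE, hcut⟩ := EdgeFlow.exists_acyclic_of_cut_le
    (isLinking_gaussianInfo_edgeMatrix τ ρ H p) s hw0 hws fun S hS ↦ by
      rw [hw, ← cutValue_subnetwork τ ρ H hp, huniv]
      exact hrate S hS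
  refine ⟨E, hE, fun S hS ↦ ?_⟩
  rw [← hw, cutValue_subnetwork τ ρ H hp]
  exact hcut S hS
end
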